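/- Let L be the language with unary predicates Q, R and a ternary relation E, and let M be the L-structure with universe (ℕ × ℕ) ⊔ {0,1}, where Q is interpreted as ℕ × ℕ, R as {0,1}, and E(x,y,r) holds iff x,y ∈ Q, r ∈ R, and x and y have the same r-th coordinate (first coordinates equal when r = 0, second coordinates equal when r = 1). Let A = {(n, n+1) : n ∈ ℕ} ⊆ Q. Then the elements 0 and 1 of R realize the same complete L-type over A in M. -/

import Mathlib

open FirstOrder Language Cardinal

universe u

namespace Benign

variable {L : FirstOrder.Language.{u, u}} {M : Type u} [L.Structure M]

/-- Two tuples (indexed by a type `α`) realize the same complete `L`-type over the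
parameter set `A`. -/
def SameTypeOver (A : Set M) {α : Type} (x y : α → M) : Prop :=
  ∀ φ : L.Formula (α ⊕ ↥A),
    φ.Realize (Sum.elim x Subtype.val) ↔ φ.Realize (Sum.elim y Subtype.val)

/-- Two tuples realize the same strong type over `A`: they realize the same type over `A`,
and they are equivalent under every `A`-definable equivalence relation with finitely many
classes. -/
def SameStrongTypeOver (A : Set M) {α : Type} (x y : α → M) : Prop :=
  SameTypeOver (L := L) A x y ∧
    ∀ φ : L.Formula ((α ⊕ α) ⊕ ↥A),
      (Equivalence fun u v : α → M => φ.Realize (Sum.elim (Sum.elim u v) Subtype.val)) →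
      (∃ k : ℕ, ∀ g : Fin (k + 1) → α → M, ∃ i j, i ≠ j ∧
          φ.Realize (Sum.elim (Sum.elim (g i) (g j)) Subtype.val)) →
      φ.Realize (Sum.elim (Sum.elim x y) Subtype.val)

/-- The language consisting of a single unary predicate symbol `P`. -/
def unaryLang : FirstOrder.Language.{0, 0} := ⟨fun _ => Empty, fun n => PLift (n = 1)⟩

/-- The interpretation of the unary predicate `P` as membership in `A`. -/
def unaryStructure (A : Set M) : unaryLang.Structure M where
  funMap := fun f _ => f.elim
  RelMap := fun {n} r v => v (Fin.cast r.down.symm 0) ∈ A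

/-- Two tuples realize the same type over `A` in the expanded language
`L* = L ∪ {P}` where the new unary predicate `P` is interpreted as `A`. -/
def SameLstarTypeOver (A : Set M) {α : Type} (x y : α → M) : Prop :=
  letI : unaryLang.Structure M := unaryStructure A
  SameTypeOver (L := L.sum unaryLang) A x y

/-- `A` is benign in `M`: tuples with the same `L`-type over `A` have the same `L*`-type
over `A`. -/
def IsBenign (A : Set M) : Prop :=
  ∀ (n : ℕ) (x y : Fin n → M),
    SameTypeOver (L := L) A x y → SameLstarTypeOver (L := L) A x y

/-- `A` is weakly benign in `M`: tuples with the same strong type over `A` have the same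
`L*`-type over `A`. -/
def IsWeaklyBenign (A : Set M) : Prop :=
  ∀ (n : ℕ) (x y : Fin n → M),
    SameStrongTypeOver (L := L) A x y → SameLstarTypeOver (L := L) A x y

/-! ### The concrete example: `Q = ℕ × ℕ`, `R = {0, 1}`,
`E(x, y, r)` iff `x, y ∈ Q`, `r ∈ R` and `x, y` have the same `r`-th coordinate. -/

/-- The relation symbols: at arity 1 the two predicates `Q` (`true`) and `R` (`false`),
at arity 3 the single relation `E`. -/
def QRERels : ℕ → Type
  | 1 => Bool
  | 3 => Unit
  | _ => Empty

/-- The language with unary predicates `Q`, `R` and a ternary relation `E`. -/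
def LQRE : FirstOrder.Language.{0, 0} := ⟨fun _ => Empty, QRERels⟩

/-- The universe `(ℕ × ℕ) ⊔ {0, 1}`. -/
abbrev MQRE : Type := (ℕ × ℕ) ⊕ Fin 2

/-- The interpretation of the relation symbols: `Q` is `ℕ × ℕ`, `R` is `{0, 1}`, and
`E(x, y, r)` holds iff `x, y ∈ Q`, `r ∈ R`, and the first coordinates of `x` and `y`
agree when `r = 0`, the second coordinates agree when `r = 1`. -/
def QRERelInterp : ∀ n, QRERels n → (Fin n → MQRE) → Prop
  | 1, true, v => ∃ p : ℕ × ℕ, v 0 = Sum.inl p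
  | 1, false, v => ∃ r : Fin 2, v 0 = Sum.inr r
  | 3, _, v => ∃ (p q : ℕ × ℕ) (r : Fin 2), v 0 = Sum.inl p ∧ v 1 = Sum.inl q ∧
      v 2 = Sum.inr r ∧ (if r = 0 then p.1 = q.1 else p.2 = q.2)

instance : LQRE.Structure MQRE where
  funMap := fun f _ => f.elim
  RelMap := fun {n} r v => QRERelInterp n r v

/-- The set `A = {(n, n + 1) : n ∈ ℕ} ⊆ Q`: it meets every `E(·,·,0)`-class exactly once,
every `E(·,·,1)`-class except the one with second coordinate `0` exactly once, and no two
of its members are equivalent under either equivalence relation. -/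
def AQRE : Set MQRE := Set.range fun n : ℕ => (Sum.inl (n, n + 1) : MQRE)


/-- The permutation of `ℕ` that cycles `0, 1, …, N` downwards, sending `k + 1` to `k` for `k < N`
and `0` to `N`, and fixes every `k > N`. -/
def downCycle (N : ℕ) : Equiv.Perm ℕ where
  toFun k := if k = 0 then N else if k ≤ N then k - 1 else k
  invFun k := if k < N then k + 1 else if k = N then 0 else k
  left_inv k := by grind
  right_inv k := by grind

theorem downCycle_succ {N n : ℕ} (h : n < N) : downCycle N (n + 1) = n := by
  simp [downCycle, Nat.succ_le_of_lt h]

/-- The automorphism of `MQRE` that swaps the two elements of `R` and exchanges the two coordinates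
on `Q`, applying `σ` to the second coordinate and `σ⁻¹` to the first one. -/
def coordSwap (σ : Equiv.Perm ℕ) : MQRE ≃[LQRE] MQRE where
  toEquiv := Equiv.sumCongr ((Equiv.prodComm ℕ ℕ).trans (Equiv.prodCongr σ σ.symm))
    (Equiv.swap 0 1)
  map_fun' f _ := f.elim
  map_rel' {n} r v := by
    change QRERelInterp n r _ ↔ QRERelInterp n r v
    match n, r with
    | 1, true => cases h : v 0 <;> simp [QRERelInterp, h]
    | 1, false => cases h : v 0 <;> simp [QRERelInterp, h]
    | 3, () =>
      rcases h₀ : v 0 with p | p <;> rcases h₁ : v 1 with q | q <;>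
        rcases h₂ : v 2 with r | r <;> simp [QRERelInterp, h₀, h₁, h₂]
      fin_cases r <;> simp

theorem coordSwap_inl (σ : Equiv.Perm ℕ) (p : ℕ × ℕ) :
    coordSwap σ (Sum.inl p) = Sum.inl (σ p.2, σ.symm p.1) := rfl

theorem coordSwap_inr_zero (σ : Equiv.Perm ℕ) : coordSwap σ (Sum.inr 0) = Sum.inr 1 := rfl

/-- Whether a formula is realized depends only on the values of its free variables. -/
theorem realize_congr_of_eqOn_freeVarFinset {L : FirstOrder.Language} {M α : Type*}
    [L.Structure M] [DecidableEq α] (φ : L.Formula α) {v w : α → M}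
    (h : ∀ a ∈ φ.freeVarFinset, v a = w a) : φ.Realize v ↔ φ.Realize w := by
  have hv := BoundedFormula.realize_restrictFreeVar (φ := φ) (n := 0)
    (f := id) (v := fun a => v a) v (fun _ => rfl) (xs := default)
  have hw := BoundedFormula.realize_restrictFreeVar (φ := φ) (n := 0)
    (f := id) (v := fun a => v a) w (fun a => (h a a.2)) (xs := default)
  exact hv.symm.trans hw

/-- The elements `0` and `1` of `R` realize the same complete
`L`-type over `A` in `M`. -/
theorem zero_one_sameTypeOver_AQRE :
    SameTypeOver (L := LQRE) AQRE ![(Sum.inr 0 : MQRE)] ![(Sum.inr 1 : MQRE)] := by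
  classical
  intro φ
  choose idx h_idx using fun a : AQRE => a.2
  let N := φ.freeVarFinset.sup (Sum.elim (fun _ => 0) fun a => idx a + 1)
  rw [← StrongHomClass.realize_formula (coordSwap (downCycle N)) φ]
  refine realize_congr_of_eqOn_freeVarFinset φ ?_
  rintro (i | a) ha
  · fin_cases i
    exact coordSwap_inr_zero _
  · have hlt : idx a < N :=
      Finset.le_sup (f := Sum.elim (fun _ => 0) fun a => idx a + 1) ha
    have hsucc := downCycle_succ hlt
    simp only [Function.comp_apply, Sum.elim_inr, ← h_idx a, coordSwap_inl, hsucc]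
    rw [(Equiv.symm_apply_eq _).2 hsucc.symm]

end Benign
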